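/- Let c : (X × Y) × (X × Y) → ℝ be a decomposable cost, c((x, y), (x', y')) = c₁(x, x') + c₂(y, y'), with c₁, c₂ nonnegative and measurable, let μ, ν be probability measures on X × Y, and let 1 ≤ α < ∞. Suppose an optimal coupling γ*_x ∈ Γ(μ_x, ν_x) attaining W_{α,c₁}(μ_x, ν_x) exists. Then W_{α,c}(μ, ν) ≤ W_{α,c₁}(μ_x, ν_x) + ( ∫ W_{α,c₂}(μ_{y|x}(·|x), ν_{y|x}(·|x'))^α dγ*_x(x, x') )^{1/α}, where μ_{y|x} and ν_{y|x} denote the disintegrations (conditional distributions of the second coordinate given the first) of μ and ν. -/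

import Mathlib

open MeasureTheory ProbabilityTheory

/-- A coupling of `μ` and `ν`: a joint measure on the product with the given marginals. -/
def IsCoupling {A B : Type*} [MeasurableSpace A] [MeasurableSpace B]
    (γ : Measure (A × B)) (μ : Measure A) (ν : Measure B) : Prop :=
  γ.map Prod.fst = μ ∧ γ.map Prod.snd = ν

/-- The `α`-Wasserstein distance between `μ` and `ν` with cost function `c`:
`W_{α,c}(μ,ν) = (inf_{γ ∈ Γ(μ,ν)} ∫ c^α dγ)^{1/α}`. -/
noncomputable def Wass {A B : Type*} [MeasurableSpace A] [MeasurableSpace B]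
    (α : ℝ) (c : A × B → ℝ) (μ : Measure A) (ν : Measure B) : ℝ :=
  sInf { r | ∃ γ : Measure (A × B), IsCoupling γ μ ν ∧ r = ∫ z, c z ^ α ∂γ } ^ (1 / α)

/-- The 1-Wasserstein distance between `μ` and `ν` with cost function `c`. -/
noncomputable def W1 {A B : Type*} [MeasurableSpace A] [MeasurableSpace B]
    (c : A × B → ℝ) (μ : Measure A) (ν : Measure B) : ℝ :=
  sInf { r | ∃ γ : Measure (A × B), IsCoupling γ μ ν ∧ r = ∫ z, c z ∂γ }

/-- The risk of classifier `f` under joint distribution `p`, w.r.t. loss `ℓ`. -/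
noncomputable def risk {X Y : Type*} [MeasurableSpace X] [MeasurableSpace Y]
    (ℓ : Y × Y → ℝ) (f : X → Y) (p : Measure (X × Y)) : ℝ :=
  ∫ z, ℓ (f z.1, z.2) ∂p

/-- `f#p` : pushforward of a joint measure `p` under `(x, y) ↦ (f x, y)`. -/
noncomputable def jmap {X Y : Type*} [MeasurableSpace X] [MeasurableSpace Y]
    (f : X → Y) (p : Measure (X × Y)) : Measure (Y × Y) :=
  p.map (fun z => (f z.1, z.2))

instance jmap.instIsFiniteMeasure {X Y : Type*} [MeasurableSpace X] [MeasurableSpace Y]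
    (f : X → Y) (p : Measure (X × Y)) [IsFiniteMeasure p] : IsFiniteMeasure (jmap f p) := by
  unfold jmap; infer_instance

open Filter Set Topology
open scoped ENNReal

/-- An open set containing the compact box `∏ i, [0, n i]` of Baire space contains all sequences
bounded by `n` up to some finite rank. -/
theorem exists_forall_lt_le_subset_of_box_subset {n : ℕ → ℕ} {O : Set (ℕ → ℕ)} (hO : IsOpen O)
    (hn : univ.pi (fun i => Iic (n i)) ⊆ O) : ∃ k, {x : ℕ → ℕ | ∀ i < k, x i ≤ n i} ⊆ O := by
  by_contra! h
  simp only [not_subset] at h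
  choose x hxA hxO using h
  have hK : IsCompact (univ.pi (fun i => Iic (n i))) :=
    isCompact_univ_pi fun i => (finite_Iic (n i)).isCompact
  obtain ⟨y, hyK, φ, hφ, hy⟩ := hK.tendsto_subseq (x := fun k i => min (x k i) (n i))
    (fun k i _ => mem_Iic.2 (min_le_right _ _))
  have hxy : Tendsto (fun j => x (φ j)) atTop (𝓝 y) := by
    rw [tendsto_pi_nhds] at hy ⊢
    intro i
    refine (hy i).congr' ?_
    filter_upwards [hφ.tendsto_atTop.eventually_gt_atTop i] with j hj
    exact min_eq_left (hxA (φ j) i hj)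
  obtain ⟨j, hj⟩ := (hxy.eventually (hO.mem_nhds (hn hyK))).exists
  exact hxO _ hj

/-- The image of Baire space under a continuous map is inner regular with respect to compact
sets for every finite measure. -/
theorem exists_isCompact_subset_range_le_add {Z : Type*} [TopologicalSpace Z]
    [MeasurableSpace Z] (m : Measure Z) [IsFiniteMeasure m] [m.OuterRegular]
    {f : (ℕ → ℕ) → Z} (hf : Continuous f) {ε : ℝ≥0∞} (hε : ε ≠ 0) :
    ∃ K ⊆ range f, IsCompact K ∧ m (range f) ≤ m K + ε := by
  have hε2 : ε / 2 ≠ 0 := (ENNReal.half_pos hε).ne'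
  obtain ⟨δ, hδ, hδε⟩ := ENNReal.exists_pos_sum_of_countable' hε2 ℕ
  have hstep : ∀ (A : Set (ℕ → ℕ)) (k : ℕ),
      ∃ b : ℕ, m (f '' A) ≤ m (f '' (A ∩ {x | x k ≤ b})) + δ k := by
    intro A k
    have hmono : Monotone fun b : ℕ => f '' (A ∩ {x | x k ≤ b}) := fun b b' hb =>
      image_mono (inter_subset_inter_right _ fun x (hx : x k ≤ b) => hx.trans hb)
    have hU : f '' A = ⋃ b : ℕ, f '' (A ∩ {x | x k ≤ b}) := by
      rw [← image_iUnion, ← inter_iUnion]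
      congr 1
      refine (inter_eq_left.2 fun x _ => mem_iUnion.2 ⟨x k, ?_⟩).symm
      exact le_refl (x k)
    have hlim := tendsto_measure_iUnion_atTop (μ := m) hmono
    rw [← hU] at hlim
    by_cases h0 : m (f '' A) = 0
    · exact ⟨0, by simp [h0]⟩
    have hlt : m (f '' A) - δ k < m (f '' A) :=
      ENNReal.sub_lt_self (measure_ne_top _ _) h0 (hδ k).ne'
    obtain ⟨b, hb⟩ := (hlim.eventually (lt_mem_nhds hlt)).exists
    exact ⟨b, tsub_le_iff_right.1 hb.le⟩
  choose b hb using hstep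
  let A : ℕ → Set (ℕ → ℕ) := fun k => Nat.rec univ (fun k S => S ∩ {x | x k ≤ b S k}) k
  have hA : ∀ k, A (k + 1) = A k ∩ {x | x k ≤ b (A k) k} := fun k => rfl
  set n : ℕ → ℕ := fun k => b (A k) k
  have hAeq : ∀ k, A k = {x | ∀ i < k, x i ≤ n i} := by
    intro k
    induction k with
    | zero => ext x; simp [A]
    | succ k ih =>
      rw [hA]
      ext x
      have : x ∈ A k ↔ ∀ i < k, x i ≤ n i := by rw [ih]; rfl
      simp only [mem_inter_iff, this, mem_ofPred_eq, Nat.forall_lt_succ_right, n]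
  have hAm : ∀ k, m (range f) ≤ m (f '' A k) + ∑ i ∈ Finset.range k, δ i := by
    intro k
    induction k with
    | zero => simp [A]
    | succ k ih =>
      refine ih.trans ?_
      rw [hA, Finset.sum_range_succ, add_comm (∑ i ∈ Finset.range k, δ i), ← add_assoc]
      gcongr
      exact hb (A k) k
  set K : Set (ℕ → ℕ) := univ.pi fun i => Iic (n i)
  have hK : IsCompact K := isCompact_univ_pi fun i => (finite_Iic (n i)).isCompact
  obtain ⟨U, hKU, hU, hmU⟩ := (f '' K).exists_isOpen_le_add m hε2
  obtain ⟨k, hk⟩ := exists_forall_lt_le_subset_of_box_subset (hU.preimage hf)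
    (image_subset_iff.1 hKU)
  refine ⟨f '' K, image_subset_range _ _, hK.image hf, ?_⟩
  calc m (range f) ≤ m (f '' A k) + ∑ i ∈ Finset.range k, δ i := hAm k
    _ ≤ m U + ε / 2 := by
      gcongr
      · rw [hAeq]; exact image_subset_iff.2 hk
      · exact (ENNReal.sum_le_tsum _).trans hδε.le
    _ ≤ m (f '' K) + ε / 2 + ε / 2 := by gcongr
    _ = m (f '' K) + ε := by rw [add_assoc, ENNReal.add_halves]

/-- Analytic sets are measurable for the completion of any finite Borel measure. -/
theorem MeasureTheory.AnalyticSet.nullMeasurableSet {Z : Type*} [TopologicalSpace Z]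
    [PolishSpace Z] [MeasurableSpace Z] [BorelSpace Z] {s : Set Z} (hs : AnalyticSet s)
    (m : Measure Z) [IsFiniteMeasure m] : NullMeasurableSet s m := by
  rw [AnalyticSet] at hs
  obtain rfl | ⟨f, hf, rfl⟩ := hs
  · exact nullMeasurableSet_empty
  have := fun j : ℕ => exists_isCompact_subset_range_le_add m hf (ε := (j : ℝ≥0∞)⁻¹) (by simp)
  choose K hKs hK hKm using this
  have hmeas : MeasurableSet (⋃ j, K j) := .iUnion fun j => (hK j).measurableSet
  have hle : m (range f) ≤ m (⋃ j, K j) := by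
    refine ENNReal.le_of_forall_pos_le_add fun ε hε _ => ?_
    obtain ⟨j, hj⟩ := ENNReal.exists_inv_nat_lt (a := (ε : ℝ≥0∞)) (by simpa using hε.ne')
    exact (hKm j).trans (add_le_add (measure_mono (subset_iUnion _ _)) hj.le)
  exact ⟨_, hmeas, (ae_eq_of_subset_of_measure_ge (iUnion_subset hKs) hle
    hmeas.nullMeasurableSet (measure_ne_top _ _)).symm⟩

/-- A least-index selection from countably many null measurable sets is null measurable. -/
theorem nullMeasurableSet_sInf_eq {Z : Type*} [MeasurableSpace Z] {m : Measure Z}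
    {E : ℕ → Set Z} (hE : ∀ j, NullMeasurableSet (E j) m) (k : ℕ) :
    NullMeasurableSet {z | sInf {j | z ∈ E j} = k} m := by
  have hlt : ∀ k, NullMeasurableSet {z | k < sInf {j | z ∈ E j}} m := by
    intro k
    have : {z | k < sInf {j | z ∈ E j}} = (⋃ j, E j) ∩ ⋂ j ∈ Iic k, (E j)ᶜ := by
      ext z
      simp only [mem_ofPred_eq, mem_inter_iff, mem_iUnion, mem_iInter, mem_compl_iff, mem_Iic]
      constructor
      · intro h
        refine ⟨Nat.nonempty_of_pos_sInf (pos_of_gt h), fun j hj hz => ?_⟩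
        exact absurd (Nat.sInf_le (s := {j | z ∈ E j}) hz) (by omega)
      · rintro ⟨hne, h⟩
        by_contra! hle
        exact h _ hle (Nat.sInf_mem (s := {j | z ∈ E j}) hne)
    rw [this]
    exact (NullMeasurableSet.iUnion hE).inter
      (.biInter (to_countable _) fun j _ => (hE j).compl)
  cases k with
  | zero =>
    convert (hlt 0).compl using 1
    ext z; simp
  | succ k =>
    convert (hlt k).diff (hlt (k + 1)) using 1
    ext z
    simp only [mem_ofPred_eq, Set.mem_sdiff]
    omega

/-- A continuous map on Baire space has an almost everywhere measurable right inverse on its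
range. -/
theorem exists_aemeasurable_rightInverse_on_range {Z : Type*} [TopologicalSpace Z]
    [PolishSpace Z] [MeasurableSpace Z] [BorelSpace Z] (m : Measure Z) [IsFiniteMeasure m]
    {h : (ℕ → ℕ) → Z} (hh : Continuous h) :
    ∃ g : Z → ℕ → ℕ, AEMeasurable g m ∧ ∀ z ∈ range h, h (g z) = z := by
  let E : ℕ → List ℕ → Set Z := fun n s => h '' {x | PiNat.res x n = s}
  have hE : ∀ n s, NullMeasurableSet (E n s) m := by
    intro n s
    refine AnalyticSet.nullMeasurableSet ?_ m
    refine IsOpen.analyticSet_image ?_ hh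
    rw [isOpen_iff_mem_nhds]
    rintro x rfl
    filter_upwards [(PiNat.isOpen_cylinder _ x n).mem_nhds (PiNat.self_mem_cylinder x n)] with y hy
    rw [PiNat.cylinder_eq_res] at hy
    exact hy
  let p : ℕ → Z → List ℕ := fun n z =>
    Nat.rec [] (fun n t => sInf {j | z ∈ E (n + 1) (j :: t)} :: t) n
  have hp : ∀ n z, p (n + 1) z = sInf {j | z ∈ E (n + 1) (j :: p n z)} :: p n z :=
    fun n z => rfl
  have hpm : ∀ n s, NullMeasurableSet {z | p n z = s} m := by
    intro n
    induction n with
    | zero => intro s; simp [p]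
    | succ n ih =>
      intro s
      cases s with
      | nil => simp [hp]
      | cons k t =>
        convert (ih t).inter (nullMeasurableSet_sInf_eq (fun j => hE (n + 1) (j :: t)) k) using 1
        ext z
        simp only [hp, List.cons.injEq, mem_ofPred_eq, mem_inter_iff]
        constructor
        · rintro ⟨h1, h2⟩; rw [h2] at h1; exact ⟨h2, h1⟩
        · rintro ⟨h1, h2⟩; rw [h1]; exact ⟨h2, rfl⟩
  let g : Z → ℕ → ℕ := fun z n => sInf {j | z ∈ E (n + 1) (j :: p n z)}
  have hg : ∀ z n, PiNat.res (g z) n = p n z := by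
    intro z n
    induction n with
    | zero => rfl
    | succ n ih => rw [PiNat.res_succ, ih]
  refine ⟨g, ?_, ?_⟩
  · refine aemeasurable_pi_lambda _ fun n => ?_
    refine NullMeasurable.aemeasurable fun s _ => ?_
    have : (fun z => g z n) ⁻¹' s = ⋃ k ∈ s, ⋃ t, {z | p (n + 1) z = k :: t} := by
      ext z
      simp only [hp, mem_preimage, mem_iUnion, mem_ofPred_eq, List.cons.injEq, exists_prop]
      constructor
      · intro hz; exact ⟨_, hz, _, rfl, rfl⟩
      · rintro ⟨k, hk, t, rfl, -⟩; exact hk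
    rw [this]
    exact .biUnion (to_countable _) fun k _ => .iUnion fun t => hpm (n + 1) (k :: t)
  · intro z hz
    have hmem : ∀ n, z ∈ E n (p n z) := by
      intro n
      induction n with
      | zero => obtain ⟨x, rfl⟩ := hz; exact ⟨x, rfl, rfl⟩
      | succ n ih =>
        obtain ⟨x, hx, rfl⟩ := ih
        rw [hp]
        refine Nat.sInf_mem (s := {j | h x ∈ E (n + 1) (j :: p n (h x))}) ⟨x n, x, ?_, rfl⟩
        simp only [mem_ofPred_eq] at hx
        simp [hx]
    choose x hx hxz using hmem
    have hlim : Tendsto x atTop (𝓝 (g z)) := by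
      rw [tendsto_pi_nhds]
      intro i
      refine tendsto_const_nhds.congr' ?_
      filter_upwards [eventually_gt_atTop i] with n hn
      have h1 : PiNat.res (x n) n = PiNat.res (g z) n := by rw [hg]; exact hx n
      exact (PiNat.res_eq_res.1 h1 hn).symm
    have h2 := (hh.tendsto (g z)).comp hlim
    have h3 : h ∘ x = fun _ => z := funext hxz
    rw [h3] at h2
    exact tendsto_nhds_unique h2 tendsto_const_nhds

/-- The projection of a Borel set is measurable up to null sets. -/
theorem nullMeasurableSet_exists_mem {Z P : Type*} [MeasurableSpace Z] [StandardBorelSpace Z]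
    [MeasurableSpace P] [StandardBorelSpace P] (m : Measure Z) [IsFiniteMeasure m]
    {S : Set (Z × P)} (hS : MeasurableSet S) : NullMeasurableSet {z | ∃ p, (z, p) ∈ S} m := by
  let := upgradeStandardBorel Z
  convert (hS.analyticSet_image measurable_fst).nullMeasurableSet m using 1
  ext z
  simp

/-- **Measurable selection** (Jankov–von Neumann), in almost everywhere form. -/
theorem exists_measurable_ae_mem {Z P : Type*} [MeasurableSpace Z] [StandardBorelSpace Z]
    [MeasurableSpace P] [StandardBorelSpace P] [Nonempty P] (m : Measure Z) [IsFiniteMeasure m]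
    {S : Set (Z × P)} (hS : MeasurableSet S) (hm : ∀ᵐ z ∂m, ∃ p, (z, p) ∈ S) :
    ∃ g : Z → P, Measurable g ∧ ∀ᵐ z ∂m, (z, g z) ∈ S := by
  let := upgradeStandardBorel Z
  let := upgradeStandardBorel P
  have hA := hS.analyticSet
  rw [AnalyticSet] at hA
  obtain rfl | ⟨F, hF, rfl⟩ := hA
  · exact ⟨fun _ => Classical.arbitrary P, measurable_const, hm.mono fun z hz => by simp at hz⟩
  obtain ⟨g, hg, hgF⟩ := exists_aemeasurable_rightInverse_on_range m (continuous_fst.comp hF)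
  refine ⟨fun z => (F (hg.mk g z)).2, hF.measurable.snd.comp hg.measurable_mk, ?_⟩
  filter_upwards [hm, hg.ae_eq_mk] with z ⟨p, x, hx⟩ hz
  refine ⟨g z, Prod.ext (hgF z ⟨x, by simp [hx]⟩) ?_⟩
  rw [hz]

/-- Finite measures on `ℝ` of equal mass are equal if they agree on rational lower rays. -/
theorem MeasureTheory.Measure.ext_of_Iic_rat {ρ σ : Measure ℝ} [IsFiniteMeasure ρ]
    (huniv : ρ univ = σ univ) (h : ∀ q : ℚ, ρ (Iic (q : ℝ)) = σ (Iic (q : ℝ))) : ρ = σ := by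
  refine ext_of_generate_finite _ Real.borel_eq_generateFrom_Iic_rat Real.isPiSystem_Iic_rat
    ?_ huniv
  simp only [mem_iUnion, mem_singleton_iff]
  rintro _ ⟨q, rfl⟩
  exact h q

/-- The set where two Markov kernels to a standard Borel space agree is measurable. -/
theorem ProbabilityTheory.Kernel.measurableSet_setOf_eq {Z T : Type*} [MeasurableSpace Z]
    [MeasurableSpace T] [StandardBorelSpace T] (κ η : Kernel Z T) [IsMarkovKernel κ]
    [IsMarkovKernel η] : MeasurableSet {z | κ z = η z} := by
  have he := measurableEmbedding_embeddingReal T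
  have : {z | κ z = η z} = ⋂ q : ℚ, {z | κ z (embeddingReal T ⁻¹' Iic (q : ℝ)) =
      η z (embeddingReal T ⁻¹' Iic (q : ℝ))} := by
    ext z
    simp only [mem_ofPred_eq, mem_iInter]
    refine ⟨fun h q => by rw [h], fun h => ?_⟩
    have hmap : (κ z).map (embeddingReal T) = (η z).map (embeddingReal T) := by
      refine Measure.ext_of_Iic_rat ?_ fun q => ?_
      · simp [Measure.map_apply he.measurable MeasurableSet.univ]
      · simpa [Measure.map_apply he.measurable measurableSet_Iic] using h q
    rw [← he.comap_map (κ z), hmap, he.comap_map]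
  rw [this]
  refine .iInter fun q => measurableSet_eq_fun ?_ ?_ <;>
    exact Kernel.measurable_coe _ (he.measurable measurableSet_Iic)

/-- The probability measures on a standard Borel space are parametrized by a Markov kernel from a
Polish space. -/
theorem exists_kernel_forall_exists_eq (T : Type*) [MeasurableSpace T] [StandardBorelSpace T]
    [Nonempty T] : ∃ K : Kernel (ℚ → ℝ) T, IsMarkovKernel K ∧
      ∀ ρ : Measure T, IsProbabilityMeasure ρ → ∃ ω, K ω = ρ := by
  have he := measurableEmbedding_embeddingReal T
  have hid : Measurable (id : (ℚ → ℝ) → ℚ → ℝ) := measurable_id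
  let κ : Kernel (ℚ → ℝ) ℝ := ⟨fun ω => (stieltjesOfMeasurableRat id hid ω).measure,
    measurable_measure_stieltjesOfMeasurableRat hid⟩
  have hκ : IsMarkovKernel κ := ⟨fun ω => ⟨measure_stieltjesOfMeasurableRat_univ hid ω⟩⟩
  obtain ⟨i, hi, hie⟩ := he.exists_measurable_extend (measurable_id (α := T)) fun _ => inferInstance
  refine ⟨κ.map i, Kernel.IsMarkovKernel.map κ hi, fun ρ hρ => ?_⟩
  have hρ' : IsProbabilityMeasure (ρ.map (embeddingReal T)) :=
    Measure.isProbabilityMeasure_map he.measurable.aemeasurable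
  let F := cdf (ρ.map (embeddingReal T))
  let ω : ℚ → ℝ := fun q => F q
  have hω : IsRatStieltjesPoint (id : (ℚ → ℝ) → ℚ → ℝ) ω :=
    { mono := fun q r hqr => F.mono (by exact_mod_cast hqr)
      tendsto_atTop_one := (tendsto_cdf_atTop _).comp (tendsto_ratCast_atTop_iff.2 tendsto_id)
      tendsto_atBot_zero := (tendsto_cdf_atBot _).comp (tendsto_ratCast_atBot_iff.2 tendsto_id)
      iInf_rat_gt_eq := fun t =>
        (Equiv.iInf_congr (Equiv.subtypeEquivRight fun r => Rat.cast_lt.symm) fun r => rfl).trans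
          (F.iInf_rat_gt_eq t) }
  have hκω : κ ω = ρ.map (embeddingReal T) := by
    refine Measure.ext_of_Iic_rat (by simp) fun q => ?_
    have : κ ω (Iic (q : ℝ)) = ENNReal.ofReal (F q) := by
      change (stieltjesOfMeasurableRat id hid ω).measure (Iic (q : ℝ)) = _
      rw [measure_stieltjesOfMeasurableRat_Iic, stieltjesOfMeasurableRat_eq,
        toRatCDF_of_isRatStieltjesPoint hω]
      rfl
    rw [this, ofReal_cdf]
  refine ⟨ω, ?_⟩
  rw [Kernel.map_apply _ hi, hκω, Measure.map_map hi he.measurable, hie, Measure.map_id]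

/-- The optimal transport value `inf_γ ∫ c dγ` over the couplings `γ` of `μ` and `ν`. -/
noncomputable def transportValue {A B : Type*} [MeasurableSpace A] [MeasurableSpace B]
    (c : A × B → ℝ) (μ : Measure A) (ν : Measure B) : ℝ :=
  sInf { r | ∃ γ : Measure (A × B), IsCoupling γ μ ν ∧ r = ∫ z, c z ∂γ }

section transportValue

variable {A B : Type*} [MeasurableSpace A] [MeasurableSpace B]

theorem IsCoupling.isProbabilityMeasure {γ : Measure (A × B)} {μ : Measure A} {ν : Measure B}
    (h : IsCoupling γ μ ν) [IsProbabilityMeasure μ] : IsProbabilityMeasure γ := by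
  refine ⟨?_⟩
  have := congrArg (fun m => m univ) h.1
  simpa [Measure.map_apply measurable_fst MeasurableSet.univ] using this

theorem isCoupling_prod (μ : Measure A) (ν : Measure B) [IsProbabilityMeasure μ]
    [IsProbabilityMeasure ν] : IsCoupling (μ.prod ν) μ ν :=
  ⟨by simp [Measure.map_fst_prod], by simp [Measure.map_snd_prod]⟩

theorem transportValue_le {c : A × B → ℝ} (hc : ∀ z, 0 ≤ c z) {γ : Measure (A × B)}
    {μ : Measure A} {ν : Measure B} (hγ : IsCoupling γ μ ν) :
    transportValue c μ ν ≤ ∫ z, c z ∂γ :=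
  csInf_le ⟨0, by rintro _ ⟨γ, -, rfl⟩; exact integral_nonneg hc⟩ ⟨γ, hγ, rfl⟩

theorem transportValue_nonneg {c : A × B → ℝ} (hc : ∀ z, 0 ≤ c z) (μ : Measure A)
    (ν : Measure B) : 0 ≤ transportValue c μ ν :=
  Real.sInf_nonneg (by rintro _ ⟨γ, -, rfl⟩; exact integral_nonneg hc)

theorem exists_isCoupling_integral_lt {c : A × B → ℝ} (μ : Measure A) (ν : Measure B)
    [IsProbabilityMeasure μ] [IsProbabilityMeasure ν] {r : ℝ} (hr : transportValue c μ ν < r) :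
    ∃ γ : Measure (A × B), IsCoupling γ μ ν ∧ ∫ z, c z ∂γ < r := by
  obtain ⟨_, ⟨γ, hγ, rfl⟩, h⟩ := exists_lt_of_csInf_lt
    (by exact ⟨_, _, isCoupling_prod μ ν, rfl⟩) hr
  exact ⟨γ, hγ, h⟩

theorem measurableSet_isCoupling {Z P : Type*} [MeasurableSpace Z] [MeasurableSpace P]
    [StandardBorelSpace A] [StandardBorelSpace B] (K : Kernel P (A × B))
    [IsMarkovKernel K] (κ : Kernel Z A) (η : Kernel Z B) [IsMarkovKernel κ] [IsMarkovKernel η] :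
    MeasurableSet {w : Z × P | IsCoupling (K w.2) (κ w.1) (η w.1)} := by
  have h1 : IsMarkovKernel (K.map Prod.fst) := Kernel.IsMarkovKernel.map K measurable_fst
  have h2 : IsMarkovKernel (K.map Prod.snd) := Kernel.IsMarkovKernel.map K measurable_snd
  have e1 := Kernel.measurableSet_setOf_eq
    ((K.map Prod.fst).comap (Prod.snd : Z × P → P) measurable_snd)
    (κ.comap (Prod.fst : Z × P → Z) measurable_fst)
  have e2 := Kernel.measurableSet_setOf_eq
    ((K.map Prod.snd).comap (Prod.snd : Z × P → P) measurable_snd)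
    (η.comap (Prod.fst : Z × P → Z) measurable_fst)
  simp only [Kernel.comap_apply, Kernel.map_apply _ measurable_fst,
    Kernel.map_apply _ measurable_snd] at e1 e2
  exact e1.inter e2

variable {Z : Type*} [MeasurableSpace Z] [StandardBorelSpace Z]
  [StandardBorelSpace A] [StandardBorelSpace B] [Nonempty A] [Nonempty B]

/-- The transport value of a pair of kernels is almost everywhere measurable. -/
theorem aemeasurable_transportValue (m : Measure Z) [IsFiniteMeasure m] (κ : Kernel Z A)
    (η : Kernel Z B) [IsMarkovKernel κ] [IsMarkovKernel η] {c : A × B → ℝ} (hc : Measurable c)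
    (hc0 : ∀ z, 0 ≤ c z) : AEMeasurable (fun z => transportValue c (κ z) (η z)) m := by
  obtain ⟨K, hK, hKs⟩ := exists_kernel_forall_exists_eq (A × B)
  have hJ : Measurable fun ω => ∫ z, c z ∂(K ω) :=
    (hc.stronglyMeasurable.integral_kernel (κ := K)).measurable
  refine NullMeasurable.aemeasurable ?_
  have hIio : ∀ r : ℝ, NullMeasurableSet {z | transportValue c (κ z) (η z) < r} m := by
    intro r
    convert nullMeasurableSet_exists_mem m ((measurableSet_isCoupling K κ η).inter
      (measurableSet_lt (hJ.comp measurable_snd) (measurable_const (a := r)))) using 1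
    ext z
    constructor
    · intro hz
      obtain ⟨γ, hγ, hlt⟩ := exists_isCoupling_integral_lt _ _ hz
      obtain ⟨ω, rfl⟩ := hKs γ hγ.isProbabilityMeasure
      exact ⟨ω, hγ, hlt⟩
    · rintro ⟨ω, hω, hlt⟩
      exact (transportValue_le hc0 hω).trans_lt hlt
  exact measurable_of_Iio (mδ := inferInstance) hIio

/-- Nearly optimal couplings of a pair of kernels can be chosen measurably. -/
theorem exists_kernel_isCoupling_integral_le (m : Measure Z) [IsFiniteMeasure m] (κ : Kernel Z A)
    (η : Kernel Z B) [IsMarkovKernel κ] [IsMarkovKernel η] {c : A × B → ℝ} (hc : Measurable c)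
    (hc0 : ∀ z, 0 ≤ c z) {ε : ℝ} (hε : 0 < ε) :
    ∃ k : Kernel Z (A × B), IsMarkovKernel k ∧ ∀ᵐ z ∂m, IsCoupling (k z) (κ z) (η z) ∧
      ∫ w, c w ∂(k z) ≤ transportValue c (κ z) (η z) + ε := by
  obtain ⟨K, hK, hKs⟩ := exists_kernel_forall_exists_eq (A × B)
  have hJ : Measurable fun ω => ∫ z, c z ∂(K ω) :=
    (hc.stronglyMeasurable.integral_kernel (κ := K)).measurable
  have hV := aemeasurable_transportValue m κ η hc hc0
  have hS := (measurableSet_isCoupling K κ η).inter (measurableSet_le (hJ.comp measurable_snd)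
    ((hV.measurable_mk.comp measurable_fst).add_const ε))
  obtain ⟨g, hg, hgS⟩ := exists_measurable_ae_mem m hS <| by
    filter_upwards [hV.ae_eq_mk] with z hz
    obtain ⟨γ, hγ, hlt⟩ := exists_isCoupling_integral_lt (κ z) (η z)
      (lt_add_of_pos_right (transportValue c (κ z) (η z)) hε)
    obtain ⟨ω, rfl⟩ := hKs γ hγ.isProbabilityMeasure
    exact ⟨ω, hγ, hlt.le.trans_eq (congrArg (· + ε) hz)⟩
  refine ⟨K.comap g hg, inferInstance, ?_⟩
  filter_upwards [hgS, hV.ae_eq_mk] with z hz hz'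
  exact ⟨hz.1, hz.2.trans_eq (congrArg (· + ε) hz'.symm)⟩

end transportValue

theorem wass_eq_transportValue_rpow {A B : Type*} [MeasurableSpace A] [MeasurableSpace B]
    (α : ℝ) (c : A × B → ℝ) (μ : Measure A) (ν : Measure B) :
    Wass α c μ ν = transportValue (fun z => c z ^ α) μ ν ^ (1 / α) := rfl

theorem map_prodMap_compProd {Z W A B : Type*} [MeasurableSpace Z] [MeasurableSpace W]
    [MeasurableSpace A] [MeasurableSpace B] (m : Measure Z) [SFinite m] (k : Kernel Z W)
    [IsSFiniteKernel k] (κ : Kernel A B) [IsSFiniteKernel κ] {p : Z → A} {q : W → B}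
    (hp : Measurable p) (hq : Measurable q) (h : ∀ᵐ z ∂m, (k z).map q = κ (p z)) :
    (m ⊗ₘ k).map (Prod.map p q) = m.map p ⊗ₘ κ := by
  ext s hs
  rw [Measure.map_apply (hp.prodMap hq) hs, Measure.compProd_apply (hp.prodMap hq hs),
    Measure.compProd_apply hs, lintegral_map (Kernel.measurable_kernel_prodMk_left hs) hp]
  refine lintegral_congr_ae ?_
  filter_upwards [h] with z hz
  rw [← hz, Measure.map_apply hq (measurable_prodMk_left hs)]
  rfl

/-- Gluing a coupling of the first marginals with couplings of the conditional distributions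
gives a coupling of the joint distributions. -/
theorem isCoupling_map_compProd {X Y : Type*} [MeasurableSpace X] [MeasurableSpace Y]
    [StandardBorelSpace Y] [Nonempty Y] {μ ν : Measure (X × Y)} [IsProbabilityMeasure μ]
    [IsProbabilityMeasure ν] {γ : Measure (X × X)}
    (hγ : IsCoupling γ (μ.map Prod.fst) (ν.map Prod.fst)) [SFinite γ] (k : Kernel (X × X) (Y × Y))
    [IsSFiniteKernel k]
    (hk : ∀ᵐ z ∂γ, IsCoupling (k z) (μ.condKernel z.1) (ν.condKernel z.2)) :
    IsCoupling ((γ ⊗ₘ k).map fun w => ((w.1.1, w.2.1), (w.1.2, w.2.2))) μ ν := by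
  constructor
  · rw [Measure.map_map (by fun_prop) (by fun_prop)]
    refine (map_prodMap_compProd γ k μ.condKernel measurable_fst measurable_fst
      (hk.mono fun z hz => hz.1)).trans ?_
    rw [hγ.1]
    exact μ.disintegrate μ.condKernel
  · rw [Measure.map_map (by fun_prop) (by fun_prop)]
    refine (map_prodMap_compProd γ k ν.condKernel measurable_snd measurable_snd
      (hk.mono fun z hz => hz.2)).trans ?_
    rw [hγ.2]
    exact ν.disintegrate ν.condKernel

/-- Minkowski's inequality for the Bochner integral of nonnegative functions. -/
theorem integral_rpow_add_rpow_le {Ω : Type*} [MeasurableSpace Ω] {m : Measure Ω} {f g : Ω → ℝ}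
    {α : ℝ} (hα : 1 ≤ α) (hf : Measurable f) (hg : Measurable g) (hf0 : ∀ w, 0 ≤ f w)
    (hg0 : ∀ w, 0 ≤ g w) (hfi : Integrable (fun w => f w ^ α) m)
    (hgi : Integrable (fun w => g w ^ α) m) (hfgi : Integrable (fun w => (f w + g w) ^ α) m) :
    (∫ w, (f w + g w) ^ α ∂m) ^ (1 / α) ≤
      (∫ w, f w ^ α ∂m) ^ (1 / α) + (∫ w, g w ^ α ∂m) ^ (1 / α) := by
  have hα0 : 0 ≤ α := zero_le_one.trans hα
  have key : ∀ u : Ω → ℝ, (∀ w, 0 ≤ u w) → Integrable (fun w => u w ^ α) m →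
      ENNReal.ofReal ((∫ w, u w ^ α ∂m) ^ (1 / α)) =
        (∫⁻ w, ENNReal.ofReal (u w) ^ α ∂m) ^ (1 / α) := by
    intro u hu hui
    have hu' : ∀ w, 0 ≤ u w ^ α := fun w => Real.rpow_nonneg (hu w) α
    rw [← ENNReal.ofReal_rpow_of_nonneg (integral_nonneg hu') (by positivity),
      ofReal_integral_eq_lintegral_ofReal hui (ae_of_all _ hu')]
    simp_rw [ENNReal.ofReal_rpow_of_nonneg (hu _) hα0]
  have hfn : 0 ≤ (∫ w, f w ^ α ∂m) ^ (1 / α) :=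
    Real.rpow_nonneg (integral_nonneg fun w => Real.rpow_nonneg (hf0 w) α) _
  have hgn : 0 ≤ (∫ w, g w ^ α ∂m) ^ (1 / α) :=
    Real.rpow_nonneg (integral_nonneg fun w => Real.rpow_nonneg (hg0 w) α) _
  rw [← ENNReal.ofReal_le_ofReal_iff (add_nonneg hfn hgn), ENNReal.ofReal_add hfn hgn,
    key f hf0 hfi, key g hg0 hgi, key (fun w => f w + g w) (fun w => add_nonneg (hf0 w) (hg0 w))
    hfgi]
  simp_rw [ENNReal.ofReal_add (hf0 _) (hg0 _)]
  exact ENNReal.lintegral_Lp_add_le hf.ennreal_ofReal.aemeasurable hg.ennreal_ofReal.aemeasurable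
    hα

theorem statement3 {X Y : Type*} [MeasurableSpace X] [MeasurableSpace Y]
    [StandardBorelSpace X] [StandardBorelSpace Y] [Nonempty Y]
    (c₁ : X × X → ℝ) (c₂ : Y × Y → ℝ)
    (hc₁meas : Measurable c₁) (hc₂meas : Measurable c₂)
    (hc₁nonneg : ∀ z, 0 ≤ c₁ z) (hc₂nonneg : ∀ z, 0 ≤ c₂ z)
    (μ ν : Measure (X × Y)) [IsProbabilityMeasure μ] [IsProbabilityMeasure ν]
    (α : ℝ) (hα : 1 ≤ α)
    (γx : Measure (X × X)) (hγx : IsCoupling γx (μ.map Prod.fst) (ν.map Prod.fst))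
    (hγxopt : (∫ z, c₁ z ^ α ∂γx) ^ (1 / α) =
      Wass α c₁ (μ.map Prod.fst) (ν.map Prod.fst)) :
    Wass α (fun z : (X × Y) × (X × Y) => c₁ (z.1.1, z.2.1) + c₂ (z.1.2, z.2.2)) μ ν ≤
      Wass α c₁ (μ.map Prod.fst) (ν.map Prod.fst) +
        (∫ z, Wass α c₂ (μ.condKernel z.1) (ν.condKernel z.2) ^ α ∂γx) ^ (1 / α) := by
  have hα0 : 0 < α := zero_lt_one.trans_le hα
  have hc₁α : ∀ z, 0 ≤ c₁ z ^ α := fun z => Real.rpow_nonneg (hc₁nonneg z) α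
  have hc₂α : ∀ z, 0 ≤ c₂ z ^ α := fun z => Real.rpow_nonneg (hc₂nonneg z) α
  have hμX : IsProbabilityMeasure (μ.map Prod.fst) :=
    Measure.isProbabilityMeasure_map measurable_fst.aemeasurable
  have hγprob : IsProbabilityMeasure γx := hγx.isProbabilityMeasure
  let κ : Kernel (X × X) Y := μ.condKernel.comap Prod.fst measurable_fst
  let η : Kernel (X × X) Y := ν.condKernel.comap Prod.snd measurable_snd
  let V : X × X → ℝ := fun z => transportValue (fun w => c₂ w ^ α) (κ z) (η z)
  have hV0 : ∀ z, 0 ≤ V z := fun z => transportValue_nonneg hc₂α _ _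
  have hWV : ∀ z : X × X, Wass α c₂ (μ.condKernel z.1) (ν.condKernel z.2) ^ α = V z := by
    intro z
    rw [wass_eq_transportValue_rpow, ← Real.rpow_mul (transportValue_nonneg hc₂α _ _),
      one_div_mul_cancel hα0.ne', Real.rpow_one]
    rfl
  simp_rw [hWV]
  rw [← hγxopt]
  set c : (X × Y) × (X × Y) → ℝ := fun z => c₁ (z.1.1, z.2.1) + c₂ (z.1.2, z.2.2)
  have hcmeas : Measurable c := by fun_prop
  have hcα : ∀ z, 0 ≤ c z ^ α := fun z =>
    Real.rpow_nonneg (add_nonneg (hc₁nonneg _) (hc₂nonneg _)) α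
  rw [wass_eq_transportValue_rpow]
  by_cases hall : ∀ γ, IsCoupling γ μ ν → Integrable (fun z => c z ^ α) γ
  swap
  · -- A coupling of infinite cost has Bochner integral zero.
    push Not at hall
    obtain ⟨γ, hγ, hγi⟩ := hall
    have h0 : transportValue (fun z => c z ^ α) μ ν = 0 :=
      le_antisymm ((transportValue_le hcα hγ).trans_eq (integral_undef hγi))
        (transportValue_nonneg hcα _ _)
    rw [h0, Real.zero_rpow (by positivity)]
    exact add_nonneg (Real.rpow_nonneg (integral_nonneg hc₁α) _)
      (Real.rpow_nonneg (integral_nonneg hV0) _)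
  have hbound : ∀ ε > 0, transportValue (fun z => c z ^ α) μ ν ^ (1 / α) ≤
      (∫ z, c₁ z ^ α ∂γx) ^ (1 / α) + (∫ z, V z ∂γx + ε) ^ (1 / α) := by
    intro ε hε
    obtain ⟨k, hk, hkγ⟩ := exists_kernel_isCoupling_integral_le γx κ η
      (hc₂meas.pow_const α) hc₂α hε
    have hγ := isCoupling_map_compProd hγx k (hkγ.mono fun z hz => hz.1)
    have hmap : Measurable fun w : (X × X) × (Y × Y) => ((w.1.1, w.2.1), (w.1.2, w.2.2)) := by
      fun_prop
    have hsum : Integrable (fun w : (X × X) × (Y × Y) => (c₁ w.1 + c₂ w.2) ^ α) (γx ⊗ₘ k) :=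
      (integrable_map_measure (hcmeas.pow_const α).aestronglyMeasurable hmap.aemeasurable).1
        (hall _ hγ)
    have hi₁ : Integrable (fun w : (X × X) × (Y × Y) => c₁ w.1 ^ α) (γx ⊗ₘ k) := by
      refine hsum.mono' (Measurable.aestronglyMeasurable (by fun_prop)) (ae_of_all _ fun w => ?_)
      rw [Real.norm_of_nonneg (hc₁α _)]
      exact Real.rpow_le_rpow (hc₁nonneg _) (le_add_of_nonneg_right (hc₂nonneg _)) hα0.le
    have hi₂ : Integrable (fun w : (X × X) × (Y × Y) => c₂ w.2 ^ α) (γx ⊗ₘ k) := by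
      refine hsum.mono' (Measurable.aestronglyMeasurable (by fun_prop)) (ae_of_all _ fun w => ?_)
      rw [Real.norm_of_nonneg (hc₂α _)]
      exact Real.rpow_le_rpow (hc₂nonneg _) (le_add_of_nonneg_left (hc₁nonneg _)) hα0.le
    have he₁ : ∫ w : (X × X) × (Y × Y), c₁ w.1 ^ α ∂(γx ⊗ₘ k) = ∫ z, c₁ z ^ α ∂γx := by
      rw [Measure.integral_compProd hi₁]
      simp
    have he₂ : ∫ w : (X × X) × (Y × Y), c₂ w.2 ^ α ∂(γx ⊗ₘ k) =
        ∫ z, ∫ y, c₂ y ^ α ∂(k z) ∂γx := Measure.integral_compProd hi₂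
    have hki : Integrable (fun z => ∫ y, c₂ y ^ α ∂(k z)) γx :=
      Integrable.integral_compProd (κ := Kernel.const Unit γx) (η := Kernel.prodMkLeft Unit k)
        (a := ()) hi₂
    have hVi : Integrable V γx := by
      refine hki.mono' (aemeasurable_transportValue γx κ η (hc₂meas.pow_const α)
        hc₂α).aestronglyMeasurable ?_
      filter_upwards [hkγ] with z hz
      rw [Real.norm_of_nonneg (hV0 z)]
      exact transportValue_le hc₂α hz.1
    have hle : ∫ z, ∫ y, c₂ y ^ α ∂(k z) ∂γx ≤ ∫ z, V z ∂γx + ε := by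
      calc _ ≤ ∫ z, (V z + ε) ∂γx :=
            integral_mono_ae hki (hVi.add (integrable_const ε)) (hkγ.mono fun z hz => hz.2)
        _ = _ := by rw [integral_add hVi (integrable_const ε)]; simp
    calc transportValue (fun z => c z ^ α) μ ν ^ (1 / α)
        ≤ (∫ w : (X × X) × (Y × Y), (c₁ w.1 + c₂ w.2) ^ α ∂(γx ⊗ₘ k)) ^ (1 / α) := by
          refine Real.rpow_le_rpow (transportValue_nonneg hcα _ _) ?_ (by positivity)
          refine (transportValue_le hcα hγ).trans_eq ?_
          exact integral_map hmap.aemeasurable (hcmeas.pow_const α).aestronglyMeasurable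
      _ ≤ _ := integral_rpow_add_rpow_le hα (by fun_prop) (by fun_prop)
          (fun w => hc₁nonneg w.1) (fun w => hc₂nonneg w.2) hi₁ hi₂ hsum
      _ ≤ _ := by
          rw [he₁, he₂]
          gcongr
          exact integral_nonneg fun z => integral_nonneg hc₂α
  have hlim : Tendsto (fun ε : ℝ => (∫ z, c₁ z ^ α ∂γx) ^ (1 / α) +
      (∫ z, V z ∂γx + ε) ^ (1 / α)) (𝓝[>] 0)
      (𝓝 ((∫ z, c₁ z ^ α ∂γx) ^ (1 / α) + (∫ z, V z ∂γx + 0) ^ (1 / α))) := by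
    refine tendsto_nhdsWithin_of_tendsto_nhds (Continuous.tendsto ?_ 0)
    exact continuous_const.add ((continuous_const.add continuous_id).rpow_const
      fun _ => Or.inr (by positivity))
  rw [add_zero] at hlim
  exact ge_of_tendsto hlim (eventually_nhdsWithin_of_forall hbound)
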